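/- Let μ be symmetric and take c = 0 with masses M_0, …, M_{2r+1} ≥ 0. Suppose there is a strictly increasing function f: ℕ → ℝ with 2f(0)+1 > 0 such that for every j ∈ {0,…,r+1} and every k ≥ 0 there exist nonzero constants C_{k,j}, C'_{k,j} with lim_{n→∞} (p_{2n}^{[4j]})^{(2k)}(0)/((−1)^n n^{f(2k+2j)}) = C_{k,j} and lim_{n→∞} (p_{2n+1}^{[4j]})^{(2k+1)}(0)/((−1)^n n^{f(2k+2j+1)}) = C'_{k,j}. Then the coefficients λ_{j,n} and λ*_{j,n} in the connection formulas q_{2n}(x) = Σ_{j=0}^{r+1} λ_{j,n} x^{2j} p_{2n−2j}^{[4j]}(x) and q_{2n+1}(x) = Σ_{j=0}^{r+1} λ*_{j,n} x^{2j} p_{2n+1−2j}^{[4j]}(x) have finite limits λ_j = lim_n λ_{j,n} and λ*_j = lim_n λ*_{j,n} for each j = 0,…,r+1. Moreover, if all the masses M_0, …, M_{2r+1} are positive, then λ_j = λ*_j = 0 for j = 0,…,r while λ_{r+1} ≠ 0 and λ*_{r+1} ≠ 0. -/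

import Mathlib

open MeasureTheory Polynomial Filter Topology

noncomputable section

/-- The support of a Borel measure on `ℝ`. -/
def measSupport (μ : Measure ℝ) : Set ℝ := {x | ∀ U ∈ nhds x, μ U ≠ 0}

/-- `P` is a sequence of orthonormal polynomials with respect to the measure `μ`. -/
def IsOPS (μ : Measure ℝ) (P : ℕ → Polynomial ℝ) : Prop :=
  (∀ n, (P n).degree = n) ∧ (∀ n, 0 < (P n).leadingCoeff) ∧
    ∀ n m, (∫ x, (P n).eval x * (P m).eval x ∂μ) = if n = m then 1 else 0

/-- The modified measure `dμ_j(x) = x^j dμ(x)` (that is, `(x-c)^j dμ` with `c = 0`). -/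
def muMod (μ : Measure ℝ) (c : ℝ) (j : ℕ) : Measure ℝ :=
  μ.withDensity fun x => ENNReal.ofReal ((x - c) ^ j)

/-- The discrete Sobolev inner product. -/
def sobInner (μ : Measure ℝ) (c : ℝ) (r : ℕ) (M : ℕ → ℝ) (p q : Polynomial ℝ) : ℝ :=
  (∫ x, p.eval x * q.eval x ∂μ) +
    ∑ i ∈ Finset.range (r + 1),
      M i * (Polynomial.derivative^[i] p).eval c * (Polynomial.derivative^[i] q).eval c

/-- `Q` is the sequence of orthonormal polynomials for the Sobolev inner product. -/
def IsSobOPS (μ : Measure ℝ) (c : ℝ) (r : ℕ) (M : ℕ → ℝ) (Q : ℕ → Polynomial ℝ) : Prop :=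
  (∀ n, (Q n).degree = n) ∧ (∀ n, 0 < (Q n).leadingCoeff) ∧
    ∀ n m, sobInner μ c r M (Q n) (Q m) = if n = m then 1 else 0

/-- Cesàro-type summation of a sequence with power-type asymptotics. -/
lemma tendsto_sum_range_div_rpow {x : ℕ → ℝ} {α L : ℝ} (hα : -1 < α)
    (h : Tendsto (fun n : ℕ => x n / (n : ℝ) ^ α) atTop (𝓝 L)) :
    Tendsto (fun n : ℕ => (∑ m ∈ Finset.range n, x m) / (n : ℝ) ^ (α + 1)) atTop
      (𝓝 (L / (α + 1))) := by
  have hβ : 0 < α + 1 := by linarith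
  set d : ℕ → ℝ := fun m => ((m + 1 : ℕ) : ℝ) ^ (α + 1) - (m : ℝ) ^ (α + 1) with hd
  have hd_nonneg : 0 ≤ d := fun m => sub_nonneg.2
    (Real.rpow_le_rpow (Nat.cast_nonneg m) (by push_cast; linarith) hβ.le)
  have hd_sum : ∀ n : ℕ, ∑ m ∈ Finset.range n, d m = (n : ℝ) ^ (α + 1) := fun n => by
    rw [Finset.sum_range_sub (fun m : ℕ => (m : ℝ) ^ (α + 1))]
    simp [Real.zero_rpow hβ.ne']
  have hd_lim : Tendsto (fun m : ℕ => d m / (m : ℝ) ^ α) atTop (𝓝 (α + 1)) := by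
    have h1 : HasDerivAt (fun t : ℝ => t ^ (α + 1)) (α + 1) 1 := by
      simpa using Real.hasDerivAt_rpow_const (x := 1) (p := α + 1) (Or.inl one_ne_zero)
    have h2 := (h1.tendsto_slope_zero_right).comp
      (tendsto_inv_atTop_nhdsGT_zero.comp (tendsto_natCast_atTop_atTop (R := ℝ)))
    refine h2.congr' ?_
    filter_upwards [eventually_gt_atTop 0] with m hm
    have hm' : (0 : ℝ) < m := Nat.cast_pos.2 hm
    have e1 : ((m + 1 : ℕ) : ℝ) ^ (α + 1) = (m : ℝ) ^ (α + 1) * (1 + (m : ℝ)⁻¹) ^ (α + 1) := by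
      rw [← Real.mul_rpow hm'.le (by positivity)]
      congr 1
      push_cast
      field_simp
    have e2 : (m : ℝ) ^ (α + 1) = (m : ℝ) ^ α * m := by
      rw [Real.rpow_add hm', Real.rpow_one]
    have e3 : (m : ℝ) ^ α ≠ 0 := (Real.rpow_pos_of_pos hm' α).ne'
    simp only [Function.comp, hd, e1, smul_eq_mul, Real.one_rpow, inv_inv]
    rw [e2]
    field_simp
  have hlo : (fun m => x m - L / (α + 1) * d m) =o[atTop] d := by
    have hd_pos : ∀ᶠ m : ℕ in atTop, d m ≠ 0 := by
      filter_upwards [hd_lim.eventually (lt_mem_nhds hβ)] with m hm h0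
      simp [h0] at hm
    rw [Asymptotics.isLittleO_iff_tendsto' (hd_pos.mono fun m hm h0 => absurd h0 hm)]
    have h3 := (h.div hd_lim hβ.ne').sub_const (L / (α + 1))
    rw [sub_self] at h3
    refine h3.congr' ?_
    filter_upwards [hd_pos, eventually_gt_atTop 0] with m hm hm0
    have e3 : (m : ℝ) ^ α ≠ 0 := (Real.rpow_pos_of_pos (Nat.cast_pos.2 hm0) α).ne'
    simp only [Pi.div_apply]
    rw [div_div_div_cancel_right₀ e3, sub_div, mul_div_assoc, div_self hm, mul_one]
  have hsum := hlo.sum_range hd_nonneg (by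
    simp only [hd_sum]
    exact (tendsto_rpow_atTop hβ).comp tendsto_natCast_atTop_atTop)
  simp only [Finset.sum_sub_distrib, ← Finset.mul_sum, hd_sum] at hsum
  have h4 := (hsum.tendsto_div_nhds_zero).add_const (L / (α + 1))
  rw [zero_add] at h4
  refine h4.congr' ?_
  filter_upwards [eventually_gt_atTop 0] with m hm0
  have e3 : (m : ℝ) ^ (α + 1) ≠ 0 := (Real.rpow_pos_of_pos (Nat.cast_pos.2 hm0) _).ne'
  field_simp
  ring

/-- Nondegeneracy of Cauchy matrices, including the case of one additional node. -/
lemma eq_zero_of_sum_div_eq_const {S T : Finset ℕ} {F : ℕ → ℝ} (hF : Function.Injective F)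
    (hpos : ∀ i l, F i + F l + 1 ≠ 0) {b : ℕ → ℝ} {e : ℝ}
    (hcard : S.card ≤ T.card) (he : e = 0 ∨ S.card < T.card)
    (h : ∀ i ∈ T, ∑ l ∈ S, b l / (F i + F l + 1) = e) : ∀ l ∈ S, b l = 0 := by
  set p : ℝ[X] := Polynomial.C e * ∏ l ∈ S, (X + Polynomial.C (F l + 1)) -
    ∑ l ∈ S, Polynomial.C (b l) * ∏ k ∈ S.erase l, (X + Polynomial.C (F k + 1)) with hp
  have hprod : ∀ S' : Finset ℕ,
      (∏ l ∈ S', (X + Polynomial.C (F l + 1)) : ℝ[X]).degree = S'.card := fun S' => by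
    rw [degree_prod, Finset.sum_congr rfl fun l _ => degree_X_add_C (F l + 1)]
    simp
  have hdeg : p.degree < T.card := by
    refine (degree_sub_le _ _).trans_lt (max_lt ?_ ?_)
    · rcases he with rfl | he
      · simp
      · refine (degree_mul_le_of_le degree_C_le le_rfl).trans_lt ?_
        rw [hprod, zero_add]
        exact_mod_cast he
    · refine (degree_sum_le _ _).trans_lt ((Finset.sup_lt_iff (WithBot.bot_lt_coe _)).2 ?_)
      intro l hl
      refine (degree_mul_le_of_le degree_C_le le_rfl).trans_lt ?_
      rw [hprod, zero_add]
      exact_mod_cast (Finset.card_erase_lt_of_mem hl).trans_le hcard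
  have hp0 : p = 0 := by
    refine eq_zero_of_degree_lt_of_eval_index_eq_zero T (v := F) hF.injOn hdeg fun i hi => ?_
    simp only [hp, eval_sub, eval_mul, eval_C, eval_prod, eval_add, eval_X, eval_finsetSum]
    rw [← h i hi, Finset.sum_mul, sub_eq_zero]
    refine Finset.sum_congr rfl fun l hl => ?_
    rw [← Finset.mul_prod_erase S _ hl]
    have := hpos i l
    rw [← add_assoc]
    field_simp
  intro l hl
  have h0 : p.eval (-(F l + 1)) = 0 := by rw [hp0, eval_zero]
  simp only [hp, eval_sub, eval_mul, eval_C, eval_prod, eval_add, eval_X, eval_finsetSum] at h0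
  rw [Finset.prod_eq_zero hl (by ring), mul_zero, zero_sub, neg_eq_zero,
    Finset.sum_eq_single_of_mem l hl] at h0
  · refine (mul_eq_zero.1 h0).resolve_right (Finset.prod_ne_zero_iff.2 fun k hk => ?_)
    rw [Finset.mem_erase] at hk
    intro h1
    exact hk.1 (hF (by linarith))
  · intro k hk hkl
    rw [Finset.prod_eq_zero (Finset.mem_erase.2 ⟨hkl.symm, hl⟩) (by ring), mul_zero]

/-- Solutions of convergent linear systems with invertible limit matrix converge. -/
lemma exists_tendsto_of_mulVec_eq {ι : Type*} [Fintype ι] [DecidableEq ι]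
    {A : ℕ → Matrix ι ι ℝ} {A' : Matrix ι ι ℝ} {y a : ℕ → ι → ℝ} {a' : ι → ℝ}
    (hA : Tendsto A atTop (𝓝 A')) (ha : Tendsto a atTop (𝓝 a')) (hdet : A'.det ≠ 0)
    (h : ∀ᶠ n in atTop, (A n).mulVec (y n) = a n) :
    ∃ Y, Tendsto y atTop (𝓝 Y) ∧ A'.mulVec Y = a' := by
  have hdetlim : Tendsto (fun n => (A n).det) atTop (𝓝 A'.det) :=
    ((show Continuous fun B : Matrix ι ι ℝ => B.det from
      continuous_id.matrix_det).tendsto A').comp hA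
  have hadj : Tendsto (fun n => (A n).adjugate) atTop (𝓝 A'.adjugate) :=
    ((show Continuous fun B : Matrix ι ι ℝ => B.adjugate from
      continuous_id.matrix_adjugate).tendsto A').comp hA
  have hmul : Tendsto (fun n => (A n).adjugate.mulVec (a n)) atTop
      (𝓝 (A'.adjugate.mulVec a')) := by
    refine tendsto_pi_nhds.2 fun i => tendsto_finsetSum _ fun l _ => ?_
    have h1 : Tendsto (fun n => (A n).adjugate i l) atTop (𝓝 (A'.adjugate i l)) :=
      ((show Continuous fun B : Matrix ι ι ℝ => B i l from
        continuous_id.matrix_elem i l).tendsto A'.adjugate).comp hadj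
    exact h1.mul (tendsto_pi_nhds.1 ha l)
  refine ⟨A'.det⁻¹ • A'.adjugate.mulVec a', ?_, ?_⟩
  · refine ((hdetlim.inv₀ hdet).smul hmul).congr' ?_
    filter_upwards [h, hdetlim.eventually_ne hdet] with n hn hn0
    rw [← hn, Matrix.mulVec_mulVec, Matrix.adjugate_mul, Matrix.smul_mulVec, Matrix.one_mulVec,
      inv_smul_smul₀ hn0]
  · rw [Matrix.mulVec_smul, Matrix.mulVec_mulVec, Matrix.mul_adjugate, Matrix.smul_mulVec,
      Matrix.one_mulVec, inv_smul_smul₀ hdet]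

/-- The abstract asymptotic argument: `u i n` are the (normalized) Taylor coefficients at `0` of a
Sobolev orthonormal polynomial, expressed through the corresponding coefficients `v i n` of the
orthonormal polynomials of the unperturbed measure and through a triangular system with solution
`lam n j`. -/
theorem exists_tendsto_connection_coefficients (s : ℕ) {F : ℕ → ℝ} (hF : StrictMono F)
    (hF0 : 0 < 2 * F 0 + 1) {m : ℕ → ℝ} (hm : ∀ l < s, 0 ≤ m l)
    {v : ℕ → ℕ → ℝ} {A : ℕ → ℝ}
    (hv : ∀ i ≤ s, Tendsto (fun n : ℕ => v i n / ((-1 : ℝ) ^ n * (n : ℝ) ^ F i)) atTop (𝓝 (A i)))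
    (hA : ∀ i ≤ s, A i ≠ 0)
    {E : ℕ → ℕ → ℕ → ℝ} {B : ℕ → ℕ → ℝ}
    (hE : ∀ i ≤ s, ∀ j ≤ i,
      Tendsto (fun n : ℕ => E i j n / ((-1 : ℝ) ^ n * (n : ℝ) ^ F i)) atTop (𝓝 (B i j)))
    (hB : ∀ j ≤ s, B j j ≠ 0)
    {c : ℕ → ℝ} {u lam : ℕ → ℕ → ℝ} (hc : ∀ᶠ n in atTop, 0 < c n)
    (hu : ∀ᶠ n in atTop, ∀ i ≤ s, u i n = c n * v i n -
      ∑ l ∈ Finset.range s, m l * u l n * ∑ k ∈ Finset.range n, v l k * v i k)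
    (hnorm : ∀ᶠ n in atTop, c n * (c n + ∑ l ∈ Finset.range s, m l * u l n * v l n) = 1)
    (hlam : ∀ᶠ n in atTop, ∀ i ≤ s, u i n = ∑ j ∈ Finset.range (i + 1), lam n j * E i j n) :
    ∀ j ≤ s, ∃ L, Tendsto (fun n => lam n j) atTop (𝓝 L) ∧
      ((∀ l < s, 0 < m l) → (j < s → L = 0) ∧ (j = s → L ≠ 0)) := by
  have hFpos : ∀ i l, 0 < F i + F l + 1 := fun i l => by
    have h1 := hF.monotone (Nat.zero_le i)
    have h2 := hF.monotone (Nat.zero_le l)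
    linarith
  set K : ℕ → ℕ → ℕ → ℝ := fun i l n => ∑ k ∈ Finset.range n, v l k * v i k with hK_def
  have hneg : ∀ n : ℕ, ((-1 : ℝ) ^ n) * (-1) ^ n = 1 := fun n => by
    rw [← mul_pow]; simp
  have hK : ∀ i ≤ s, ∀ l ≤ s, Tendsto (fun n : ℕ => K i l n / (n : ℝ) ^ (F i + F l + 1)) atTop
      (𝓝 (A l * A i / (F i + F l + 1))) := by
    intro i hi l hl
    refine tendsto_sum_range_div_rpow (by linarith [hFpos i l]) ?_
    refine ((hv l hl).mul (hv i hi)).congr' ?_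
    filter_upwards [eventually_gt_atTop 0] with n hn
    rw [div_mul_div_comm, mul_mul_mul_comm, hneg, one_mul, add_comm (F i),
      Real.rpow_add (Nat.cast_pos.2 hn)]
  set S : Finset ℕ := (Finset.range s).filter fun l => 0 < m l with hS
  have hSlt : ∀ l ∈ S, l < s ∧ 0 < m l := fun l hl => by simpa [hS] using hl
  have hsumS : ∀ g : ℕ → ℝ, ∑ l ∈ Finset.range s, m l * g l = ∑ l ∈ S, m l * g l := by
    intro g
    rw [hS, Finset.sum_filter]
    refine Finset.sum_congr rfl fun l hl => ?_
    split_ifs with h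
    · rfl
    · rw [le_antisymm (not_lt.1 h) (hm l (Finset.mem_range.1 hl)), zero_mul]
  set y : ℕ → ℕ → ℝ := fun n l => m l * u l n * ((-1 : ℝ) ^ n * (n : ℝ) ^ (F l + 1)) / c n
    with hy_def
  have hu' : ∀ᶠ n : ℕ in atTop, ∀ i ≤ s, u i n / (c n * ((-1 : ℝ) ^ n * (n : ℝ) ^ F i)) =
      v i n / ((-1 : ℝ) ^ n * (n : ℝ) ^ F i) -
        ∑ l ∈ S, K i l n / (n : ℝ) ^ (F i + F l + 1) * y n l := by
    filter_upwards [hu, hc, eventually_gt_atTop 0] with n hun hcn hn i hi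
    have hn' : (0 : ℝ) < n := Nat.cast_pos.2 hn
    have h1 := hun i hi
    simp only [mul_assoc] at h1
    rw [hsumS] at h1
    rw [h1, sub_div, mul_div_mul_left _ _ hcn.ne', Finset.sum_div]
    congr 1
    refine Finset.sum_congr rfl fun l _ => ?_
    have e1 : (n : ℝ) ^ (F i + F l + 1) = (n : ℝ) ^ F i * (n : ℝ) ^ (F l + 1) := by
      rw [← Real.rpow_add hn', add_assoc]
    have e2 := (Real.rpow_pos_of_pos hn' (F i)).ne'
    have e3 := (Real.rpow_pos_of_pos hn' (F l + 1)).ne'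
    simp only [hy_def, hK_def]
    rw [e1]
    rcases neg_one_pow_eq_or ℝ n with h | h <;> rw [h] <;> field_simp
  obtain ⟨Y, hY, hYeq⟩ : ∃ Y : ℕ → ℝ, (∀ l ∈ S, Tendsto (fun n => y n l) atTop (𝓝 (Y l))) ∧
      ∀ i ∈ S, ∑ l ∈ S, A l * A i / (F i + F l + 1) * Y l = A i := by
    let G : ℕ → Matrix S S ℝ := fun n i l => K i l n / (n : ℝ) ^ (F i + F l + 1) +
      if i = l then (m l)⁻¹ * ((n : ℝ) ^ (2 * F l + 1))⁻¹ else 0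
    let G' : Matrix S S ℝ := fun i l => A l * A i / (F i + F l + 1)
    have hG : Tendsto G atTop (𝓝 G') := by
      refine tendsto_pi_nhds.2 fun i => tendsto_pi_nhds.2 fun l => ?_
      rw [← add_zero (G' i l)]
      refine (hK i (hSlt i i.2).1.le l (hSlt l l.2).1.le).add ?_
      split_ifs with h
      · rw [← mul_zero (m l)⁻¹]
        refine (tendsto_inv_atTop_zero.comp ((tendsto_rpow_atTop ?_).comp
          tendsto_natCast_atTop_atTop)).const_mul _
        linarith [hFpos l l]
      · exact tendsto_const_nhds
    have ha : Tendsto (fun (n : ℕ) (i : S) => v i n / ((-1 : ℝ) ^ n * (n : ℝ) ^ F i)) atTop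
        (𝓝 fun i => A i) := tendsto_pi_nhds.2 fun i => hv i (hSlt i i.2).1.le
    have hdet : G'.det ≠ 0 := by
      intro h0
      obtain ⟨w, hw, hw0⟩ := Matrix.exists_mulVec_eq_zero_iff.2 h0
      refine hw (funext fun l => ?_)
      have h2 := eq_zero_of_sum_div_eq_const (S := S) (T := S) hF.injective
        (fun i l => (hFpos i l).ne') (b := fun l => if h : l ∈ S then A l * w ⟨l, h⟩ else 0)
        (e := 0) le_rfl (Or.inl rfl) (fun i hi => ?_) l l.2
      · simp only [l.2, dite_true] at h2
        exact (mul_eq_zero.1 h2).resolve_left (hA l (hSlt l l.2).1.le)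
      · have h3 := congrFun hw0 ⟨i, hi⟩
        simp only [Matrix.mulVec, dotProduct, Pi.zero_apply, G'] at h3
        have h4 := hA i (hSlt i hi).1.le
        rw [← Finset.sum_coe_sort]
        refine mul_left_cancel₀ h4 ?_
        rw [Finset.mul_sum, mul_zero, ← h3]
        refine Finset.sum_congr rfl fun l _ => ?_
        simp only [l.2, dite_true]
        ring
    obtain ⟨Y, hY, hYeq⟩ := exists_tendsto_of_mulVec_eq (y := fun n (l : S) => y n l) hG ha hdet (by
      filter_upwards [hu', hc, eventually_gt_atTop 0] with n hun hcn hn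
      have hn' : (0 : ℝ) < n := Nat.cast_pos.2 hn
      funext i
      have h1 := hun i (hSlt i i.2).1.le
      rw [eq_sub_iff_add_eq, ← Finset.sum_coe_sort] at h1
      rw [← h1]
      simp only [Matrix.mulVec, dotProduct, G, add_mul, Finset.sum_add_distrib, ite_mul, zero_mul,
        Finset.sum_ite_eq, Finset.mem_univ, if_true]
      rw [add_comm]
      congr 1
      have e1 : (n : ℝ) ^ (2 * F i + 1) = (n : ℝ) ^ F i * (n : ℝ) ^ (F i + 1) := by
        rw [← Real.rpow_add hn']
        congr 1
        ring
      have e2 := (Real.rpow_pos_of_pos hn' (F i)).ne'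
      have e3 := (Real.rpow_pos_of_pos hn' (F i + 1)).ne'
      have e5 := (hSlt i i.2).2.ne'
      simp only [hy_def]
      rw [e1]
      rcases neg_one_pow_eq_or ℝ n with h | h <;> rw [h] <;> field_simp)
    refine ⟨fun l => if h : l ∈ S then Y ⟨l, h⟩ else 0, fun l hl => ?_, fun i hi => ?_⟩
    · simpa only [hl, dite_true] using tendsto_pi_nhds.1 hY ⟨l, hl⟩
    · rw [← Finset.sum_coe_sort]
      refine Eq.trans (Finset.sum_congr rfl fun l _ => ?_) (congrFun hYeq ⟨i, hi⟩)
      simp only [l.2, dite_true, G']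
  have hclim : Tendsto c atTop (𝓝 1) := by
    have h1 : Tendsto (fun n : ℕ => 1 + ∑ l ∈ S, y n l * (v l n / ((-1 : ℝ) ^ n * (n : ℝ) ^ F l)) *
        (n : ℝ)⁻¹) atTop (𝓝 (1 + ∑ l ∈ S, Y l * A l * 0)) :=
      (tendsto_finsetSum _ fun l hl => ((hY l hl).mul (hv l (hSlt l hl).1.le)).mul
        (tendsto_inv_atTop_zero.comp tendsto_natCast_atTop_atTop)).const_add 1
    simp only [mul_zero, Finset.sum_const_zero, add_zero] at h1
    have h2 : Tendsto (fun n : ℕ => √((1 + ∑ l ∈ S, y n l *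
        (v l n / ((-1 : ℝ) ^ n * (n : ℝ) ^ F l)) * (n : ℝ)⁻¹)⁻¹)) atTop (𝓝 1) := by
      simpa using (h1.inv₀ one_ne_zero).sqrt
    refine h2.congr' ?_
    filter_upwards [hnorm, hc, eventually_gt_atTop 0] with n hnn hcn hn
    have hn' : (0 : ℝ) < n := Nat.cast_pos.2 hn
    have h3 : ∑ l ∈ S, y n l * (v l n / ((-1 : ℝ) ^ n * (n : ℝ) ^ F l)) * (n : ℝ)⁻¹ =
        (∑ l ∈ Finset.range s, m l * u l n * v l n) / c n := by
      simp only [mul_assoc]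
      rw [hsumS, Finset.sum_div]
      refine Finset.sum_congr rfl fun l _ => ?_
      have e1 : (n : ℝ) ^ (F l + 1) = (n : ℝ) ^ F l * n := by
        rw [Real.rpow_add hn', Real.rpow_one]
      have e2 := (Real.rpow_pos_of_pos hn' (F l)).ne'
      simp only [hy_def]
      rw [e1]
      rcases neg_one_pow_eq_or ℝ n with h | h <;> rw [h] <;> field_simp
    have h4 : (1 + (∑ l ∈ Finset.range s, m l * u l n * v l n) / c n)⁻¹ = c n ^ 2 := by
      refine inv_eq_of_mul_eq_one_left (Eq.trans ?_ hnn)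
      field_simp
    rw [h3, h4, Real.sqrt_sq hcn.le]
  have hulim : ∀ i ≤ s, Tendsto (fun n : ℕ => u i n / ((-1 : ℝ) ^ n * (n : ℝ) ^ F i)) atTop
      (𝓝 (A i - ∑ l ∈ S, A l * A i / (F i + F l + 1) * Y l)) := by
    intro i hi
    have h1 := hclim.mul ((hv i hi).sub (tendsto_finsetSum S fun l hl =>
      (hK i hi l (hSlt l hl).1.le).mul (hY l hl)))
    rw [one_mul] at h1
    refine h1.congr' ?_
    filter_upwards [hu', hc] with n hun hcn
    rw [← hun i hi, ← mul_div_assoc, mul_div_mul_left _ _ hcn.ne']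
  set U : ℕ → ℝ := fun i => A i - ∑ l ∈ S, A l * A i / (F i + F l + 1) * Y l with hU
  have hstep : ∀ j ≤ s, ∀ L : ℕ → ℝ, (∀ i < j, Tendsto (fun n => lam n i) atTop (𝓝 (L i))) →
      Tendsto (fun n => lam n j) atTop (𝓝 ((U j - ∑ i ∈ Finset.range j, L i * B j i) / B j j)) := by
    intro j hj L hL
    refine (((hulim j hj).sub (tendsto_finsetSum _ fun i hi => (hL i (Finset.mem_range.1 hi)).mul
      (hE j hj i (Finset.mem_range.1 hi).le))).div (hE j hj j le_rfl) (hB j hj)).congr' ?_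
    filter_upwards [hlam, (hE j hj j le_rfl).eventually_ne (hB j hj), eventually_gt_atTop 0]
      with n hln hne hn
    have hσ : (-1 : ℝ) ^ n * (n : ℝ) ^ F j ≠ 0 := mul_ne_zero (pow_ne_zero _ (by norm_num))
      (Real.rpow_pos_of_pos (Nat.cast_pos.2 hn) _).ne'
    have hE0 : E j j n ≠ 0 := fun h => hne (by rw [h, zero_div])
    simp only [Pi.div_apply]
    rw [hln j hj, Finset.sum_range_succ]
    simp only [mul_div_assoc', ← Finset.sum_div]
    rw [← sub_div, div_div_div_cancel_right₀ hσ]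
    field_simp
    ring
  have hex : ∃ L : ℕ → ℝ, ∀ j ≤ s, Tendsto (fun n => lam n j) atTop (𝓝 (L j)) := by
    have : ∀ j, ∃ L, j ≤ s → Tendsto (fun n => lam n j) atTop (𝓝 L) := by
      intro j
      induction j using Nat.strong_induction_on with
      | _ j ih =>
        choose! L hL using ih
        exact ⟨_, fun hj => hstep j hj L fun i hi => hL i hi (hi.le.trans hj)⟩
    choose L hL using this
    exact ⟨L, hL⟩
  obtain ⟨L, hL⟩ := hex
  have hLeq : ∀ j ≤ s, L j = (U j - ∑ i ∈ Finset.range j, L i * B j i) / B j j := fun j hj =>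
    tendsto_nhds_unique (hL j hj) (hstep j hj L fun i hi => hL i (hi.le.trans hj))
  refine fun j hj => ⟨L j, hL j hj, fun hmpos => ?_⟩
  have hSmem : ∀ l < s, l ∈ S := fun l hl => by simp [hS, hl, hmpos l hl]
  have hL0 : ∀ j < s, L j = 0 := by
    intro j
    induction j using Nat.strong_induction_on with
    | _ j ih =>
      intro hj
      rw [hLeq j hj.le, Finset.sum_eq_zero fun i hi => ?_, hU]
      · simp only [hYeq j (hSmem j hj), sub_self, zero_div]
      · rw [ih i (Finset.mem_range.1 hi) ((Finset.mem_range.1 hi).trans hj), zero_mul]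
  refine ⟨fun hj => hL0 j hj, ?_⟩
  rintro rfl
  rw [hLeq j le_rfl, Finset.sum_eq_zero fun i hi => by
    rw [hL0 i (Finset.mem_range.1 hi), zero_mul], sub_zero]
  refine div_ne_zero (fun hUj => ?_) (hB j le_rfl)
  have hjS : j ∉ S := fun h => (hSlt j h).1.false
  have hone : ∀ i ∈ insert j S, ∑ l ∈ S, A l * Y l / (F i + F l + 1) = 1 := by
    intro i hi
    have hAi : A i ≠ 0 := hA i <| by
      rcases Finset.mem_insert.1 hi with rfl | h
      · exact le_rfl
      · exact (hSlt i h).1.le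
    have h1 : ∑ l ∈ S, A l * A i / (F i + F l + 1) * Y l = A i := by
      rcases Finset.mem_insert.1 hi with rfl | h
      · exact (sub_eq_zero.1 hUj).symm
      · exact hYeq i h
    refine mul_left_cancel₀ hAi ?_
    rw [mul_one, Finset.mul_sum, ← h1]
    refine Finset.sum_congr rfl fun l _ => ?_
    rw [h1]
    ring
  have hzero := eq_zero_of_sum_div_eq_const hF.injective (fun i l => (hFpos i l).ne')
    (by simp [hjS]) (Or.inr (by simp [hjS])) hone
  have h1 := hone j (Finset.mem_insert_self j S)
  rw [Finset.sum_eq_zero fun l hl => by rw [hzero l hl, zero_div]] at h1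
  exact zero_ne_one h1

/-- The bilinear form `I (p q x ^ k) + ∑_{l < t} w_l p_l q_l`, where `p_l`, `q_l` are the
coefficients of `p` and `q`. -/
def sobForm (I : ℝ[X] →ₗ[ℝ] ℝ) (k t : ℕ) (w : ℕ → ℝ) : ℝ[X] →ₗ[ℝ] ℝ[X] →ₗ[ℝ] ℝ :=
  LinearMap.mk₂ ℝ
    (fun p q => I (p * q * X ^ k) + ∑ l ∈ Finset.range t, w l * p.coeff l * q.coeff l)
    (fun p p' q => by
      simp only [add_mul, map_add, coeff_add, mul_add, Finset.sum_add_distrib]; ring)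
    (fun a p q => by
      simp only [smul_mul_assoc, map_smul, coeff_smul, smul_eq_mul, mul_add, Finset.mul_sum]
      congr 1
      exact Finset.sum_congr rfl fun l _ => by ring)
    (fun p q q' => by
      simp only [add_mul, map_add, coeff_add, mul_add, Finset.sum_add_distrib]; ring)
    (fun a p q => by
      simp only [smul_mul_assoc, mul_smul_comm, map_smul, coeff_smul, smul_eq_mul, mul_add,
        Finset.mul_sum]
      congr 1
      exact Finset.sum_congr rfl fun l _ => by ring)

lemma sobForm_apply (I : ℝ[X] →ₗ[ℝ] ℝ) (k t : ℕ) (w : ℕ → ℝ) (p q : ℝ[X]) :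
    sobForm I k t w p q =
      I (p * q * X ^ k) + ∑ l ∈ Finset.range t, w l * p.coeff l * q.coeff l := rfl

lemma sobForm_comm (I : ℝ[X] →ₗ[ℝ] ℝ) (k t : ℕ) (w : ℕ → ℝ) (p q : ℝ[X]) :
    sobForm I k t w p q = sobForm I k t w q p := by
  rw [sobForm_apply, sobForm_apply, mul_comm p q]
  congr 1
  exact Finset.sum_congr rfl fun l _ => by ring

/-- A sequence of polynomials, one in each degree, orthonormal with respect to a bilinear form. -/
structure IsOrthoSeq (B : ℝ[X] →ₗ[ℝ] ℝ[X] →ₗ[ℝ] ℝ) (P : ℕ → ℝ[X]) : Prop where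
  degree_eq : ∀ n, (P n).degree = n
  ortho : ∀ n m, B (P n) (P m) = if n = m then 1 else 0

lemma mem_span_image_Iio_of_degree_lt {P : ℕ → ℝ[X]} (hP : ∀ n, (P n).degree = n) {n : ℕ}
    {p : ℝ[X]} (hp : p.degree < n) : p ∈ Submodule.span ℝ (P '' Set.Iio n) := by
  let S : Polynomial.Sequence ℝ := ⟨P, hP⟩
  have h := S.span_degreeLT (m := n) fun i _ =>
    isUnit_iff_ne_zero.2 (leadingCoeff_ne_zero.2 (S.ne_zero i))
  exact h ▸ mem_degreeLT.2 hp

namespace IsOrthoSeq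

variable {B : ℝ[X] →ₗ[ℝ] ℝ[X] →ₗ[ℝ] ℝ} {P : ℕ → ℝ[X]}

lemma expansion (hP : IsOrthoSeq B P) {n : ℕ} {p : ℝ[X]} (hp : p.degree < n) :
    p = ∑ m ∈ Finset.range n, B p (P m) • P m := by
  have h := mem_span_image_Iio_of_degree_lt hP.degree_eq hp
  induction h using Submodule.span_induction with
  | mem x hx =>
    obtain ⟨k, hk, rfl⟩ := hx
    simp only [hP.ortho, ite_smul, one_smul, zero_smul, Finset.sum_ite_eq,
      Finset.mem_range.2 (Set.mem_Iio.1 hk), if_true]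
  | zero => simp
  | add x y hx hy hx' hy' =>
    simp only [map_add, LinearMap.add_apply, add_smul, Finset.sum_add_distrib]
    have hlt : ∀ z ∈ Submodule.span ℝ (P '' Set.Iio n), z.degree < n := fun z hz => by
      refine mem_degreeLT.1 (Submodule.span_le.2 ?_ hz)
      rintro _ ⟨k, hk, rfl⟩
      simpa [mem_degreeLT, hP.degree_eq] using hk
    rw [← hx' (hlt x hx), ← hy' (hlt y hy)]
  | smul a x hx hx' =>
    have hlt : ∀ z ∈ Submodule.span ℝ (P '' Set.Iio n), z.degree < n := fun z hz => by
      refine mem_degreeLT.1 (Submodule.span_le.2 ?_ hz)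
      rintro _ ⟨k, hk, rfl⟩
      simpa [mem_degreeLT, hP.degree_eq] using hk
    simp only [map_smul, LinearMap.smul_apply, smul_assoc, ← Finset.smul_sum]
    rw [← hx' (hlt x hx)]

lemma apply_eq_zero (hP : IsOrthoSeq B P) {n : ℕ} {p : ℝ[X]} (hp : p.degree < n) :
    B (P n) p = 0 := by
  rw [hP.expansion hp, map_sum]
  refine Finset.sum_eq_zero fun m hm => ?_
  rw [map_smul, hP.ortho, if_neg (Finset.mem_range.1 hm).ne', smul_zero]

lemma coeff_eq_zero_of_odd {I : ℝ[X] →ₗ[ℝ] ℝ} (hI : ∀ p, I (p.comp (-X)) = I p) {k t : ℕ}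
    (hk : Even k) {w : ℕ → ℝ} (hP : IsOrthoSeq (sobForm I k t w) P) {i n : ℕ}
    (h : Odd (i + n)) : (P n).coeff i = 0 := by
  have hcoeff : ∀ (p : ℝ[X]) l, (p.comp (-X)).coeff l = (-1) ^ l * p.coeff l := fun p l => by
    have : (-X : ℝ[X]) = Polynomial.C (-1) * X := by simp
    rw [this, comp_C_mul_X_coeff, mul_comm]
  have hinv : ∀ p p', sobForm I k t w (p.comp (-X)) (p'.comp (-X)) = sobForm I k t w p p' := by
    intro p p'
    rw [sobForm_apply, sobForm_apply, ← hI (p * p' * X ^ k)]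
    congr 1
    · simp [hk.neg_pow]
    · refine Finset.sum_congr rfl fun l _ => ?_
      rw [hcoeff, hcoeff]
      rcases neg_one_pow_eq_or ℝ l with h | h <;> rw [h] <;> ring
  set R := (P n).comp (-X) - Polynomial.C ((-1) ^ n) * P n with hR
  have hRcoeff : ∀ l, R.coeff l = ((-1) ^ l - (-1) ^ n) * (P n).coeff l := fun l => by
    rw [hR, coeff_sub, hcoeff, coeff_C_mul]
    ring
  have hRdeg : R.degree < n := by
    rw [degree_lt_iff_coeff_zero]
    intro l hl
    rw [hRcoeff]
    rcases hl.eq_or_lt with rfl | hl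
    · rw [sub_self, zero_mul]
    · rw [coeff_eq_zero_of_degree_lt (by rw [hP.degree_eq]; exact_mod_cast hl), mul_zero]
  have hR0 : R = 0 := by
    rw [hP.expansion hRdeg]
    refine Finset.sum_eq_zero fun m hm => ?_
    have hm' := Finset.mem_range.1 hm
    have h1 : sobForm I k t w ((P n).comp (-X)) (P m) = 0 := by
      rw [← hinv, comp_neg_X_comp_neg_X]
      refine hP.apply_eq_zero ?_
      rw [degree_lt_iff_coeff_zero]
      intro l hl
      rw [hcoeff, coeff_eq_zero_of_degree_lt, mul_zero]
      rw [hP.degree_eq]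
      exact_mod_cast hm'.trans_le hl
    rw [hR, map_sub, LinearMap.sub_apply, h1, ← smul_eq_C_mul, map_smul, LinearMap.smul_apply,
      hP.ortho, if_neg hm'.ne', smul_zero, sub_zero, zero_smul]
  have h1 := hRcoeff i
  rw [hR0, coeff_zero] at h1
  refine (mul_eq_zero.1 h1.symm).resolve_left ?_
  have h2 : (-1 : ℝ) ^ i * (-1) ^ n = -1 := by rw [← pow_add, h.neg_one_pow]
  intro h3
  rw [sub_eq_zero.1 h3, ← pow_add, Even.neg_one_pow ⟨n, rfl⟩] at h2
  norm_num at h2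

section Sobolev

variable {I : ℝ[X] →ₗ[ℝ] ℝ} {t : ℕ} {w : ℕ → ℝ} {p q : ℕ → ℝ[X]}

lemma degree_sub_smul_lt (hp : ∀ n, (p n).degree = n) (hq : ∀ n, (q n).degree = n) (N : ℕ) :
    (q N - ((q N).leadingCoeff / (p N).leadingCoeff) • p N).degree < N := by
  have hp0 : p N ≠ 0 := fun h => by simpa [h] using hp N
  have hq0 : q N ≠ 0 := fun h => by simpa [h] using hq N
  have hc0 : (q N).leadingCoeff / (p N).leadingCoeff ≠ 0 :=
    div_ne_zero (leadingCoeff_ne_zero.2 hq0) (leadingCoeff_ne_zero.2 hp0)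
  conv_rhs => rw [← hq N]
  refine degree_sub_lt_left ?_ hq0 ?_
  · rw [hq, degree_smul_of_smul_regular _ (IsRegular.of_ne_zero hc0).left.isSMulRegular, hp]
  · rw [leadingCoeff_smul_of_smul_regular _ (IsRegular.of_ne_zero hc0).left.isSMulRegular,
      smul_eq_mul, div_mul_cancel₀ _ (leadingCoeff_ne_zero.2 hp0)]

lemma sobForm_self_leading (hp : IsOrthoSeq (sobForm I 0 0 w) p) (hq : ∀ n, (q n).degree = n)
    (N : ℕ) : sobForm I 0 0 w (q N) (p N) = (q N).leadingCoeff / (p N).leadingCoeff := by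
  have h := hp.apply_eq_zero (degree_sub_smul_lt hp.degree_eq hq N)
  rw [map_sub, map_smul, hp.ortho, if_pos rfl, smul_eq_mul, mul_one, sub_eq_zero] at h
  rw [sobForm_comm, h]

lemma sobForm_eq_add (I : ℝ[X] →ₗ[ℝ] ℝ) (k t : ℕ) (w : ℕ → ℝ) (f g : ℝ[X]) :
    sobForm I k t w f g =
      sobForm I k 0 w f g + ∑ l ∈ Finset.range t, w l * f.coeff l * g.coeff l := by
  simp [sobForm_apply]

lemma coeff_sobolev (hp : IsOrthoSeq (sobForm I 0 0 w) p) (hq : IsOrthoSeq (sobForm I 0 t w) q)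
    (N i : ℕ) : (q N).coeff i = (q N).leadingCoeff / (p N).leadingCoeff * (p N).coeff i -
      ∑ l ∈ Finset.range t, w l * (q N).coeff l *
        ∑ m ∈ Finset.range N, (p m).coeff l * (p m).coeff i := by
  have h := hp.expansion (n := N + 1) (p := q N) (by rw [hq.degree_eq]; exact_mod_cast N.lt_succ_self)
  rw [Finset.sum_range_succ, sobForm_self_leading hp hq.degree_eq] at h
  conv_lhs => rw [h]
  rw [coeff_add, finsetSum_coeff, coeff_smul, smul_eq_mul, add_comm, sub_eq_add_neg,
    ← Finset.sum_neg_distrib]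
  congr 1
  simp only [Finset.mul_sum, ← Finset.sum_neg_distrib]
  rw [Finset.sum_comm]
  refine Finset.sum_congr rfl fun m hm => ?_
  have h1 := hq.apply_eq_zero (n := N) (p := p m)
    (by rw [hp.degree_eq]; exact_mod_cast Finset.mem_range.1 hm)
  rw [sobForm_eq_add, add_eq_zero_iff_eq_neg] at h1
  rw [h1, coeff_smul, smul_eq_mul, neg_mul, Finset.sum_mul, ← Finset.sum_neg_distrib]
  exact Finset.sum_congr rfl fun l _ => by ring

lemma norm_sobolev (hp : IsOrthoSeq (sobForm I 0 0 w) p) (hq : IsOrthoSeq (sobForm I 0 t w) q)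
    (N : ℕ) : (q N).leadingCoeff / (p N).leadingCoeff * ((q N).leadingCoeff / (p N).leadingCoeff +
      ∑ l ∈ Finset.range t, w l * (q N).coeff l * (p N).coeff l) = 1 := by
  have h := hq.apply_eq_zero (degree_sub_smul_lt hp.degree_eq hq.degree_eq N)
  rw [map_sub, map_smul, hq.ortho, if_pos rfl, smul_eq_mul, sobForm_eq_add,
    sobForm_self_leading hp hq.degree_eq, sub_eq_zero] at h
  exact h.symm

end Sobolev

end IsOrthoSeq

lemma sum_range_two_mul_add {ε : ℕ} (hε : ε < 2) {g : ℕ → ℝ} (hg : ∀ l, Odd (l + ε) → g l = 0)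
    (n : ℕ) : ∑ l ∈ Finset.range (2 * n + ε), g l = ∑ l ∈ Finset.range n, g (2 * l + ε) := by
  induction n with
  | zero =>
    refine Finset.sum_eq_zero fun l hl => hg l ?_
    have := Finset.mem_range.1 hl
    rw [Nat.odd_iff]
    omega
  | succ n ih =>
    rw [show 2 * (n + 1) + ε = 2 * n + ε + 1 + 1 by ring, Finset.sum_range_succ,
      Finset.sum_range_succ, ih, Finset.sum_range_succ,
      hg (2 * n + ε + 1) (by rw [Nat.odd_iff]; omega), add_zero]

lemma sum_range_two_mul {ε : ℕ} (hε : ε < 2) {g : ℕ → ℝ} (hg : ∀ l, Odd (l + ε) → g l = 0)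
    (n : ℕ) : ∑ l ∈ Finset.range (2 * n), g l = ∑ l ∈ Finset.range n, g (2 * l + ε) := by
  induction n with
  | zero => simp
  | succ n ih =>
    rw [show 2 * (n + 1) = 2 * n + 1 + 1 by ring, Finset.sum_range_succ,
      Finset.sum_range_succ, ih, Finset.sum_range_succ]
    interval_cases ε
    · rw [hg (2 * n + 1) (by rw [Nat.odd_iff]; omega), add_zero, add_zero]
    · rw [hg (2 * n) (by rw [Nat.odd_iff]; omega), add_zero]

/-- Existence of the connection formula for a single Sobolev orthonormal polynomial. -/
lemma exists_connection_formula {I : ℝ[X] →ₗ[ℝ] ℝ} (hI : ∀ p, I (p.comp (-X)) = I p)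
    {s : ℕ} {w : ℕ → ℝ} {P : ℕ → ℕ → ℝ[X]} {q : ℕ → ℝ[X]}
    (hP : ∀ j ≤ s, IsOrthoSeq (sobForm I (4 * j) 0 w) (P j))
    (hq : IsOrthoSeq (sobForm I 0 (2 * s) w) q) {ε : ℕ} (hε : ε < 2) {n : ℕ} (hn : s ≤ n)
    (hP0 : ∀ j < s, (P j (2 * n + ε - 2 * j)).coeff ε ≠ 0) :
    ∃ lam : ℕ → ℝ, q (2 * n + ε) = ∑ j ∈ Finset.range (s + 1),
      Polynomial.C (lam j) * X ^ (2 * j) * P j (2 * n + ε - 2 * j) := by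
  set N := 2 * n + ε with hN
  have htri : ∀ s' ≤ s, ∃ lam : ℕ → ℝ, ∀ i < s', (q N - ∑ j ∈ Finset.range s',
      Polynomial.C (lam j) * X ^ (2 * j) * P j (N - 2 * j)).coeff (2 * i + ε) = 0 := by
    intro s'
    induction s' with
    | zero => exact fun _ => ⟨0, fun i hi => absurd hi (Nat.not_lt_zero i)⟩
    | succ s' ih =>
      intro hs'
      obtain ⟨lam, hlam⟩ := ih (Nat.le_of_succ_le hs')
      set R := q N - ∑ j ∈ Finset.range s',
        Polynomial.C (lam j) * X ^ (2 * j) * P j (N - 2 * j) with hR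
      set a := R.coeff (2 * s' + ε) / (P s' (N - 2 * s')).coeff ε with ha
      refine ⟨Function.update lam s' a, fun i hi => ?_⟩
      have h1 : q N - ∑ j ∈ Finset.range (s' + 1),
          Polynomial.C (Function.update lam s' a j) * X ^ (2 * j) * P j (N - 2 * j) =
          R - Polynomial.C a * X ^ (2 * s') * P s' (N - 2 * s') := by
        rw [Finset.sum_range_succ, hR, Function.update_self, ← sub_sub]
        congr 2
        refine Finset.sum_congr rfl fun j hj => ?_
        rw [Function.update_of_ne (Finset.mem_range.1 hj).ne]
      rw [h1, coeff_sub, mul_assoc, coeff_C_mul, coeff_X_pow_mul']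
      rcases (Nat.lt_succ_iff.1 hi).lt_or_eq with hlt | rfl
      · rw [hlam i hlt, if_neg (by omega), mul_zero, sub_zero]
      · rw [if_pos (by omega), Nat.add_sub_cancel_left, ha,
          div_mul_cancel₀ _ (hP0 i (Nat.lt_of_succ_le hs')), sub_self]
  obtain ⟨lam, hlam⟩ := htri s le_rfl
  set R := q N - ∑ j ∈ Finset.range s,
    Polynomial.C (lam j) * X ^ (2 * j) * P j (N - 2 * j) with hR
  have hdvd : X ^ (2 * s) ∣ R := by
    rw [X_pow_dvd_iff]
    intro d hd
    rcases Nat.even_or_odd (d + ε) with hev | hodd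
    · obtain ⟨i, rfl⟩ : ∃ i, d = 2 * i + ε := by
        rw [Nat.even_iff] at hev
        exact ⟨(d - ε) / 2, by omega⟩
      exact hlam i (by omega)
    · rw [Nat.odd_iff] at hodd
      rw [hR, coeff_sub, hq.coeff_eq_zero_of_odd hI Even.zero (by rw [Nat.odd_iff]; omega),
        finsetSum_coeff, Finset.sum_eq_zero, sub_zero]
      intro j hj
      have hj' := Finset.mem_range.1 hj
      rw [mul_assoc, coeff_C_mul, coeff_X_pow_mul']
      split_ifs with h
      · rw [(hP j hj'.le).coeff_eq_zero_of_odd hI ⟨2 * j, by ring⟩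
          (by rw [Nat.odd_iff]; omega), mul_zero]
      · exact mul_zero _
  obtain ⟨h, hh⟩ := hdvd
  have hterm : ∀ j ≤ s, ∀ a : ℝ,
      (Polynomial.C a * X ^ (2 * j) * P j (N - 2 * j)).degree ≤ (N : WithBot ℕ) := by
    intro j hj a
    rw [mul_assoc]
    refine (degree_mul_le_of_le degree_C_le le_rfl).trans ?_
    rw [zero_add, degree_mul, degree_X_pow, (hP j hj).degree_eq]
    exact_mod_cast (by omega : 2 * j + (N - 2 * j) ≤ N)
  have hRdeg : R.degree ≤ (N : WithBot ℕ) := by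
    refine (degree_sub_le _ _).trans (max_le (hq.degree_eq N).le ?_)
    refine (degree_sum_le _ _).trans (Finset.sup_le fun j hj => ?_)
    exact hterm j (Finset.mem_range.1 hj).le _
  have hhdeg : h.degree < (N - 2 * s + 1 : ℕ) := by
    by_cases h0 : h = 0
    · rw [h0, degree_zero]
      exact WithBot.bot_lt_coe _
    · rw [hh, degree_mul, degree_X_pow, degree_eq_natDegree h0] at hRdeg
      rw [degree_eq_natDegree h0]
      have : 2 * s + h.natDegree ≤ N := by exact_mod_cast hRdeg
      exact_mod_cast (by omega : h.natDegree < N - 2 * s + 1)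
  have hexp := (hP s le_rfl).expansion hhdeg
  have hzero : ∀ m ∈ Finset.range (N - 2 * s), sobForm I (4 * s) 0 w h (P s m) = 0 := by
    intro m hm
    have hm' := Finset.mem_range.1 hm
    have h1 : sobForm I (4 * s) 0 w h (P s m) = I (R * (X ^ (2 * s) * P s m)) := by
      rw [hh, sobForm_apply]
      simp only [Finset.range_zero, Finset.sum_empty, add_zero]
      congr 1
      ring
    rw [h1, hR, sub_mul, map_sub, Finset.sum_mul, map_sum, Finset.sum_eq_zero, sub_zero]
    · have h2 := hq.apply_eq_zero (n := N) (p := X ^ (2 * s) * P s m) (by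
        rw [degree_mul, degree_X_pow, (hP s le_rfl).degree_eq]
        exact_mod_cast (by omega : 2 * s + m < N))
      rw [sobForm_apply, Finset.sum_eq_zero, add_zero, pow_zero, mul_one] at h2
      · exact h2
      · intro l hl
        rw [coeff_X_pow_mul', if_neg (by simpa using hl), mul_zero]
    · intro j hj
      have hj' := Finset.mem_range.1 hj
      have h2 := (hP j hj'.le).apply_eq_zero (n := N - 2 * j)
        (p := X ^ (2 * (s - j)) * P s m) (by
          rw [degree_mul, degree_X_pow, (hP s le_rfl).degree_eq]
          exact_mod_cast (by omega : 2 * (s - j) + m < N - 2 * j))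
      rw [sobForm_apply, Finset.range_zero, Finset.sum_empty, add_zero] at h2
      have h3 : Polynomial.C (lam j) * X ^ (2 * j) * P j (N - 2 * j) * (X ^ (2 * s) * P s m) =
          lam j • (P j (N - 2 * j) * (X ^ (2 * (s - j)) * P s m) * X ^ (4 * j)) := by
        have h4 : (X : ℝ[X]) ^ (2 * s) = X ^ (2 * (s - j)) * X ^ (2 * j) := by
          rw [← pow_add]
          congr 1
          omega
        rw [h4, smul_eq_C_mul]
        ring
      rw [h3, map_smul, h2, smul_zero]
  rw [Finset.sum_range_succ, Finset.sum_eq_zero fun m hm => by rw [hzero m hm, zero_smul],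
    zero_add] at hexp
  refine ⟨Function.update lam s (sobForm I (4 * s) 0 w h (P s (N - 2 * s))), ?_⟩
  rw [Finset.sum_range_succ, Function.update_self, mul_right_comm, ← smul_eq_C_mul, ← hexp,
    mul_comm h, ← hh, hR, Finset.sum_congr rfl fun j hj => by
      rw [Function.update_of_ne (Finset.mem_range.1 hj).ne]]
  ring

/-- Limits of the connection coefficients along one parity class of degrees. -/
theorem connection_coefficients_limits_of_parity
    {I : ℝ[X] →ₗ[ℝ] ℝ} (hI : ∀ p, I (p.comp (-X)) = I p)
    {s : ℕ} {w : ℕ → ℝ} (hw : ∀ l < 2 * s, 0 ≤ w l) {P : ℕ → ℕ → ℝ[X]} {q : ℕ → ℝ[X]}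
    (hP : ∀ j ≤ s, IsOrthoSeq (sobForm I (4 * j) 0 w) (P j))
    (hPlead : ∀ n, 0 < (P 0 n).leadingCoeff)
    (hq : IsOrthoSeq (sobForm I 0 (2 * s) w) q) (hqlead : ∀ n, 0 < (q n).leadingCoeff)
    {ε : ℕ} (hε : ε < 2) {F : ℕ → ℝ} (hF : StrictMono F) (hF0 : 0 < 2 * F 0 + 1)
    {A : ℕ → ℕ → ℝ} (hA : ∀ k, ∀ j ≤ s, A k j ≠ 0)
    (hlim : ∀ k, ∀ j ≤ s, Tendsto (fun n : ℕ => (P j (2 * n + ε)).coeff (2 * k + ε) /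
      ((-1 : ℝ) ^ n * (n : ℝ) ^ F (k + j))) atTop (𝓝 (A k j))) :
    ∃ lam : ℕ → ℕ → ℝ,
      (∀ᶠ n in atTop, q (2 * n + ε) = ∑ j ∈ Finset.range (s + 1),
        Polynomial.C (lam n j) * X ^ (2 * j) * P j (2 * n + ε - 2 * j)) ∧
      ∀ j ≤ s, ∃ L, Tendsto (fun n => lam n j) atTop (𝓝 L) ∧
        ((∀ l < 2 * s, 0 < w l) → (j < s → L = 0) ∧ (j = s → L ≠ 0)) := by
  have hp : IsOrthoSeq (sobForm I 0 0 w) (P 0) := by simpa using hP 0 (Nat.zero_le s)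
  set E : ℕ → ℕ → ℕ → ℝ := fun i j n =>
    (X ^ (2 * j) * P j (2 * n + ε - 2 * j)).coeff (2 * i + ε) with hE_def
  have hElim : ∀ i ≤ s, ∀ j ≤ i,
      Tendsto (fun n : ℕ => E i j n / ((-1 : ℝ) ^ n * (n : ℝ) ^ F i)) atTop
        (𝓝 ((-1) ^ j * A (i - j) j)) := by
    intro i hi j hj
    have h1 := (hlim (i - j) j (hj.trans hi)).comp (tendsto_sub_atTop_nat j)
    have h2 : Tendsto (fun n : ℕ => (((n - j : ℕ) : ℝ) / n) ^ F i) atTop (𝓝 1) := by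
      have h3 : Tendsto (fun n : ℕ => ((n - j : ℕ) : ℝ) / n) atTop (𝓝 1) := by
        have h4 := (tendsto_const_div_atTop_nhds_zero_nat (j : ℝ)).const_sub 1
        rw [sub_zero] at h4
        refine h4.congr' ?_
        filter_upwards [eventually_gt_atTop j] with n hn
        have : (n : ℝ) ≠ 0 := Nat.cast_ne_zero.2 (by omega)
        rw [Nat.cast_sub hn.le, sub_div, div_self this]
      simpa using h3.rpow_const (p := F i) (Or.inl one_ne_zero)
    have h5 := ((h1.mul h2).const_mul ((-1 : ℝ) ^ j))
    rw [mul_one] at h5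
    refine h5.congr' ?_
    filter_upwards [eventually_gt_atTop j] with n hn
    have hn' : (0 : ℝ) < n := Nat.cast_pos.2 (by omega)
    have hnj : (0 : ℝ) < (n - j : ℕ) := Nat.cast_pos.2 (by omega)
    simp only [Function.comp, hE_def]
    rw [coeff_X_pow_mul', if_pos (by omega), show 2 * n + ε - 2 * j = 2 * (n - j) + ε by omega,
      show 2 * i + ε - 2 * j = 2 * (i - j) + ε by omega, Nat.sub_add_cancel hj,
      Real.div_rpow hnj.le hn'.le]
    have e1 : (-1 : ℝ) ^ n = (-1) ^ (n - j) * (-1) ^ j := by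
      rw [← pow_add, Nat.sub_add_cancel hn.le]
    have e2 := (Real.rpow_pos_of_pos hn' (F i)).ne'
    have e3 := (Real.rpow_pos_of_pos hnj (F i)).ne'
    rw [e1]
    rcases neg_one_pow_eq_or ℝ j with h | h <;> rw [h] <;> field_simp
  have hA' : ∀ i j, j ≤ s → (-1) ^ j * A i j ≠ 0 := fun i j hj =>
    mul_ne_zero (pow_ne_zero _ (by norm_num)) (hA i j hj)
  have hne : ∀ᶠ n in atTop, ∀ j ∈ Finset.range s, (P j (2 * n + ε - 2 * j)).coeff ε ≠ 0 := by
    rw [Filter.eventually_all_finset]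
    intro j hj
    have hj' := (Finset.mem_range.1 hj).le
    filter_upwards [(hElim j hj' j le_rfl).eventually_ne (hA' _ j hj')] with n hn h0
    refine hn ?_
    simp only [hE_def]
    rw [coeff_X_pow_mul', if_pos (by omega), Nat.add_sub_cancel_left, h0, zero_div]
  have hex : ∀ n, ∃ lam : ℕ → ℝ, s ≤ n → (∀ j < s, (P j (2 * n + ε - 2 * j)).coeff ε ≠ 0) →
      q (2 * n + ε) = ∑ j ∈ Finset.range (s + 1),
        Polynomial.C (lam j) * X ^ (2 * j) * P j (2 * n + ε - 2 * j) := by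
    intro n
    by_cases h : s ≤ n ∧ ∀ j < s, (P j (2 * n + ε - 2 * j)).coeff ε ≠ 0
    · obtain ⟨lam, hlam⟩ := exists_connection_formula hI hP hq hε h.1 h.2
      exact ⟨lam, fun _ _ => hlam⟩
    · exact ⟨0, fun h1 h2 => absurd ⟨h1, h2⟩ h⟩
  choose lam hlam using hex
  have hconn : ∀ᶠ n in atTop, q (2 * n + ε) = ∑ j ∈ Finset.range (s + 1),
      Polynomial.C (lam n j) * X ^ (2 * j) * P j (2 * n + ε - 2 * j) := by
    filter_upwards [hne, eventually_ge_atTop s] with n hn hns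
    exact hlam n hns fun j hj => hn j (Finset.mem_range.2 hj)
  refine ⟨lam, hconn, ?_⟩
  have hqodd : ∀ n l, Odd (l + ε) → (q (2 * n + ε)).coeff l = 0 := fun n l hl =>
    hq.coeff_eq_zero_of_odd hI Even.zero (by rw [Nat.odd_iff] at hl ⊢; omega)
  have key := exists_tendsto_connection_coefficients s hF hF0 (m := fun l => w (2 * l + ε))
    (fun l hl => hw _ (by omega)) (v := fun i n => (P 0 (2 * n + ε)).coeff (2 * i + ε))
    (A := fun i => A i 0) (fun i _ => hlim i 0 (Nat.zero_le s)) (fun i _ => hA i 0 (Nat.zero_le s))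
    (E := E) (B := fun i j => (-1) ^ j * A (i - j) j) hElim (fun j hj => hA' _ j hj)
    (c := fun n => (q (2 * n + ε)).leadingCoeff / (P 0 (2 * n + ε)).leadingCoeff)
    (u := fun i n => (q (2 * n + ε)).coeff (2 * i + ε)) (lam := lam)
    (Eventually.of_forall fun n => div_pos (hqlead _) (hPlead _))
    (Eventually.of_forall fun n i _ => ?_) (Eventually.of_forall fun n => ?_) ?_
  · intro j hj
    obtain ⟨L, hL, hL'⟩ := key j hj
    exact ⟨L, hL, fun hpos => hL' fun l hl => hpos _ (by omega)⟩
  · rw [IsOrthoSeq.coeff_sobolev hp hq (2 * n + ε) (2 * i + ε)]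
    congr 1
    rw [sum_range_two_mul hε fun l hl => by rw [hqodd n l hl, mul_zero, zero_mul]]
    refine Finset.sum_congr rfl fun l _ => ?_
    congr 1
    refine sum_range_two_mul_add hε (fun m hm => ?_) n
    rw [hp.coeff_eq_zero_of_odd hI Even.zero, zero_mul]
    rw [Nat.odd_iff] at hm ⊢
    omega
  · rw [← IsOrthoSeq.norm_sobolev hp hq (2 * n + ε),
      sum_range_two_mul hε fun l hl => by rw [hqodd n l hl, mul_zero, zero_mul]]
  · filter_upwards [hconn] with n hn i hi
    rw [hn, finsetSum_coeff]
    simp only [mul_assoc, coeff_C_mul]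
    refine (Finset.sum_subset (Finset.range_mono (by omega)) fun j _ hj => ?_).symm
    rw [Finset.mem_range, not_lt] at hj
    rw [coeff_X_pow_mul', if_neg (by omega), mul_zero]

/-- The moment functional of a measure all of whose polynomial moments exist. -/
def momentFunctional (μ : Measure ℝ)
    (hint : ∀ p : ℝ[X], Integrable (fun x => p.eval x) μ) : ℝ[X] →ₗ[ℝ] ℝ where
  toFun p := ∫ x, p.eval x ∂μ
  map_add' p q := by simp only [eval_add, integral_add (hint p) (hint q)]
  map_smul' a p := by
    simp only [eval_smul, smul_eq_mul, integral_const_mul, RingHom.id_apply]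

lemma integral_muMod {μ : Measure ℝ} (j : ℕ) (g : ℝ → ℝ) :
    ∫ x, g x ∂(muMod μ 0 (4 * j)) = ∫ x, g x * x ^ (4 * j) ∂μ := by
  have h := integral_withDensity_eq_integral_smul (μ := μ)
    (f := fun x : ℝ => Real.toNNReal ((x - 0) ^ (4 * j))) (by fun_prop) g
  refine h.trans (integral_congr_ae (Eventually.of_forall fun x => ?_))
  have hx : 0 ≤ x ^ (4 * j) := Even.pow_nonneg ⟨2 * j, by ring⟩ x
  simp only [NNReal.smul_def, sub_zero, smul_eq_mul]
  rw [Real.coe_toNNReal _ hx, mul_comm]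

lemma eval_zero_iterate_derivative (p : ℝ[X]) (k : ℕ) :
    (derivative^[k] p).eval 0 = k.factorial * p.coeff k := by
  rw [← coeff_zero_eq_eval_zero, coeff_iterate_derivative, zero_add, Nat.descFactorial_self,
    nsmul_eq_mul]

/-- **Theorem 4 (symmetric case).** Under power-type asymptotics for the values
`(p_{2n}^{[4j]})^{(2k)}(0)` and `(p_{2n+1}^{[4j]})^{(2k+1)}(0)`, the coefficients in the
symmetric connection formulas have finite limits; if all the masses are positive, these
limits vanish for `j = 0,…,r` and are nonzero at `j = r+1`. -/
theorem symmetric_connection_coefficients_limits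
    (μ : Measure ℝ) [IsFiniteMeasure μ]
    (hsupp : (measSupport μ).Infinite)
    (hint : ∀ p : Polynomial ℝ, Integrable (fun x => p.eval x) μ)
    (hsym : μ.map (fun x => -x) = μ)
    (r : ℕ) (M : ℕ → ℝ) (hM : ∀ i ≤ 2 * r + 1, 0 ≤ M i)
    (P : ℕ → ℕ → Polynomial ℝ)
    (hP : ∀ j ≤ r + 1, IsOPS (muMod μ 0 (4 * j)) (P j))
    (q : ℕ → Polynomial ℝ) (hq : IsSobOPS μ 0 (2 * r + 1) M q)
    (f : ℕ → ℝ) (hf : StrictMono f) (hf0 : 0 < 2 * f 0 + 1)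
    (C C' : ℕ → ℕ → ℝ)
    (hC : ∀ k, ∀ j ≤ r + 1, C k j ≠ 0) (hC' : ∀ k, ∀ j ≤ r + 1, C' k j ≠ 0)
    (hlimEven : ∀ k, ∀ j ≤ r + 1, Filter.Tendsto
      (fun n : ℕ =>
        (Polynomial.derivative^[2 * k] (P j (2 * n))).eval 0 /
          ((-1 : ℝ) ^ n * (n : ℝ) ^ (f (2 * k + 2 * j))))
      Filter.atTop (nhds (C k j)))
    (hlimOdd : ∀ k, ∀ j ≤ r + 1, Filter.Tendsto
      (fun n : ℕ =>
        (Polynomial.derivative^[2 * k + 1] (P j (2 * n + 1))).eval 0 /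
          ((-1 : ℝ) ^ n * (n : ℝ) ^ (f (2 * k + 2 * j + 1))))
      Filter.atTop (nhds (C' k j))) :
    ∃ N : ℕ, ∃ lam lamStar : ℕ → ℕ → ℝ,
      (∀ n ≥ N,
        q (2 * n) = ∑ j ∈ Finset.range (r + 2),
          Polynomial.C (lam n j) * Polynomial.X ^ (2 * j) * P j (2 * n - 2 * j) ∧
        q (2 * n + 1) = ∑ j ∈ Finset.range (r + 2),
          Polynomial.C (lamStar n j) * Polynomial.X ^ (2 * j) * P j (2 * n + 1 - 2 * j)) ∧
      ∀ j ≤ r + 1, ∃ L LStar : ℝ,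
        Filter.Tendsto (fun n : ℕ => lam n j) Filter.atTop (nhds L) ∧
        Filter.Tendsto (fun n : ℕ => lamStar n j) Filter.atTop (nhds LStar) ∧
        ((∀ i ≤ 2 * r + 1, 0 < M i) →
          ((j ≤ r → L = 0 ∧ LStar = 0) ∧ (j = r + 1 → L ≠ 0 ∧ LStar ≠ 0))) := by
  set I := momentFunctional μ hint with hI_def
  have hI_apply : ∀ p, I p = ∫ x, p.eval x ∂μ := fun p => rfl
  have hI : ∀ p, I (p.comp (-X)) = I p := by
    intro p
    rw [hI_apply, hI_apply]
    conv_rhs => rw [← hsym, integral_map measurable_neg.aemeasurable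
      p.continuous.aestronglyMeasurable]
    simp
  set w : ℕ → ℝ := fun l => M l * (l.factorial : ℝ) ^ 2 with hw_def
  have hfac : ∀ l : ℕ, (0 : ℝ) < l.factorial := fun l => Nat.cast_pos.2 l.factorial_pos
  have hP' : ∀ j ≤ r + 1, IsOrthoSeq (sobForm I (4 * j) 0 w) (P j) := by
    refine fun j hj => ⟨(hP j hj).1, fun n m => ?_⟩
    rw [← (hP j hj).2.2 n m, integral_muMod, sobForm_apply, Finset.range_zero, Finset.sum_empty,
      add_zero, hI_apply]
    simp only [eval_mul, eval_pow, eval_X]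
  have hq' : IsOrthoSeq (sobForm I 0 (2 * (r + 1)) w) q := by
    refine ⟨hq.1, fun n m => ?_⟩
    rw [← hq.2.2 n m, sobInner, sobForm_apply, pow_zero, mul_one, hI_apply]
    simp only [eval_mul]
    congr 1
    refine Finset.sum_congr rfl fun l _ => ?_
    rw [eval_zero_iterate_derivative, eval_zero_iterate_derivative, hw_def]
    ring
  have hlim : ∀ (ε : ℕ) (A : ℕ → ℕ → ℝ), (∀ k, ∀ j ≤ r + 1, Tendsto (fun n : ℕ =>
      (derivative^[2 * k + ε] (P j (2 * n + ε))).eval 0 /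
        ((-1 : ℝ) ^ n * (n : ℝ) ^ f (2 * k + 2 * j + ε))) atTop (𝓝 (A k j))) →
      ∀ k, ∀ j ≤ r + 1, Tendsto (fun n : ℕ => (P j (2 * n + ε)).coeff (2 * k + ε) /
        ((-1 : ℝ) ^ n * (n : ℝ) ^ f (2 * (k + j) + ε))) atTop
        (𝓝 (A k j / (2 * k + ε).factorial)) := by
    intro ε A h k j hj
    refine ((h k j hj).div_const _).congr fun n => ?_
    have := (hfac (2 * k + ε)).ne'
    rw [eval_zero_iterate_derivative, mul_add 2 k j, mul_div_assoc, mul_div_cancel_left₀ _ this]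
  have main : ∀ ε < 2, ∀ A : ℕ → ℕ → ℝ, (∀ k, ∀ j ≤ r + 1, A k j ≠ 0) →
      (∀ k, ∀ j ≤ r + 1, Tendsto (fun n : ℕ =>
        (derivative^[2 * k + ε] (P j (2 * n + ε))).eval 0 /
          ((-1 : ℝ) ^ n * (n : ℝ) ^ f (2 * k + 2 * j + ε))) atTop (𝓝 (A k j))) → _ :=
    fun ε hε A hA h => connection_coefficients_limits_of_parity hI (s := r + 1) (w := w)
      (fun l hl => mul_nonneg (hM l (by omega)) (sq_nonneg _)) hP'
      (hP 0 (Nat.zero_le _)).2.1 hq' hq.2.1 hε (F := fun i => f (2 * i + ε))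
      (fun a b hab => hf (by omega))
      (by have := hf.monotone (Nat.zero_le (2 * 0 + ε)); linarith)
      (fun k j hj => div_ne_zero (hA k j hj) (hfac _).ne') (hlim ε A h)
  obtain ⟨lam, hlam, hL⟩ := main 0 (by norm_num) C hC hlimEven
  obtain ⟨lamStar, hlamStar, hLStar⟩ := main 1 (by norm_num) C' hC' hlimOdd
  obtain ⟨N, hN⟩ := eventually_atTop.1 (hlam.and hlamStar)
  refine ⟨N, lam, lamStar, fun n hn => hN n hn, fun j hj => ?_⟩
  obtain ⟨L, hLt, hL'⟩ := hL j hj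
  obtain ⟨LStar, hLSt, hLS'⟩ := hLStar j hj
  refine ⟨L, LStar, hLt, hLSt, fun hpos => ?_⟩
  have hwpos : ∀ l < 2 * (r + 1), 0 < w l := fun l hl =>
    mul_pos (hpos l (by omega)) (pow_pos (hfac l) 2)
  exact ⟨fun h => ⟨(hL' hwpos).1 (by omega), (hLS' hwpos).1 (by omega)⟩,
    fun h => ⟨(hL' hwpos).2 h, (hLS' hwpos).2 h⟩⟩
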